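/- Suppose 4·s⋆·log p ≤ n and p ≥ 3. Then for any θ₀ ∈ ℝ^p, P(λ_min(V_{n,S}) ≤ n/36 for some S ∈ 𝒮_{s⋆}) ≤ 5·exp(−n/24), where V_{n,S} = ∑_{i=1}^n exp(X_iᵀθ₀)·X_{i,S}X_{i,S}ᵀ. -/

import Mathlib

open MeasureTheory ProbabilityTheory Matrix Real

/-- The law of an `n × p` matrix with i.i.d. standard normal entries. -/
noncomputable def gaussMat (n p : ℕ) : Measure (Fin n → Fin p → ℝ) :=
  Measure.pi fun _ : Fin n => Measure.pi fun _ : Fin p => gaussianReal 0 1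

/-- Smallest eigenvalue (Rayleigh quotient infimum over unit vectors). -/
noncomputable def lamMin {m : Type*} [Fintype m] (A : Matrix m m ℝ) : ℝ :=
  sInf {r : ℝ | ∃ u : m → ℝ, (∑ i, u i ^ 2) = 1 ∧ r = u ⬝ᵥ A.mulVec u}

/-- Weighted Gram matrix `∑ᵢ wᵢ · X_{i,S} X_{i,S}ᵀ`. -/
noncomputable def gramW {n p : ℕ} (S : Finset (Fin p)) (w : Fin n → ℝ)
    (x : Fin n → Fin p → ℝ) : Matrix S S ℝ :=
  Matrix.of fun j k => ∑ i, w i * x i j.1 * x i k.1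

section SphereLaw

variable {E : Type*} [NormedAddCommGroup E] [InnerProductSpace ℝ E] [FiniteDimensional ℝ E]
  [MeasurableSpace E] [BorelSpace E]

open scoped InnerProductSpace

variable (E) in
/-- The rotation-invariant law on the unit sphere: the direction of a standard Gaussian vector. -/
noncomputable def sphereLaw : Measure E := (stdGaussian E).map fun g => ‖g‖⁻¹ • g

lemma measurable_inv_norm_smul : Measurable fun g : E => ‖g‖⁻¹ • g := by
  fun_prop

instance : IsProbabilityMeasure (sphereLaw E) :=
  Measure.isProbabilityMeasure_map measurable_inv_norm_smul.aemeasurable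

lemma stdGaussian_ae_ne_zero {v : E} (hv : v ≠ 0) : ∀ᵐ g ∂stdGaussian E, g ≠ 0 := by
  have h : (stdGaussian E).map (innerSL ℝ v) = gaussianReal 0 (‖v‖ ^ 2).toNNReal := by
    rw [IsGaussian.map_eq_gaussianReal, integral_strongDual_stdGaussian,
      variance_dual_stdGaussian]
    simp
  have : NullSingletonClass (gaussianReal 0 (‖v‖ ^ 2).toNNReal) :=
    nullSingletonClass_gaussianReal (by simpa using hv)
  have h0 : ∀ᵐ y ∂(stdGaussian E).map (innerSL ℝ v), y ≠ 0 := by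
    rw [h]
    exact Measure.ae_ne _ _
  have h1 := ae_of_ae_map (by fun_prop) h0
  filter_upwards [h1] with g hg h'
  simp [h'] at hg

lemma sphereLaw_ae_norm {v : E} (hv : v ≠ 0) : ∀ᵐ u ∂sphereLaw E, ‖u‖ = 1 := by
  rw [sphereLaw, ae_map_iff measurable_inv_norm_smul.aemeasurable
    (measurableSet_eq_fun measurable_norm measurable_const)]
  filter_upwards [stdGaussian_ae_ne_zero hv] with g hg
  rw [norm_smul, norm_inv, norm_norm, inv_mul_cancel₀ (norm_ne_zero_iff.2 hg)]

lemma integral_sphereLaw_comp_isometry (R : E ≃ₗᵢ[ℝ] E) (f : E → ℝ) (hf : Continuous f) :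
    ∫ u, f (R u) ∂sphereLaw E = ∫ u, f u ∂sphereLaw E := by
  have hR : (sphereLaw E).map R = sphereLaw E := by
    have : (R : E → E) ∘ (fun g : E => ‖g‖⁻¹ • g) = (fun g : E => ‖g‖⁻¹ • g) ∘ R := by
      ext g; simp
    rw [sphereLaw, Measure.map_map (by fun_prop) measurable_inv_norm_smul, this,
      ← Measure.map_map measurable_inv_norm_smul (by fun_prop), stdGaussian_map]
  conv_rhs => rw [← hR]
  rw [integral_map (by fun_prop) hf.aestronglyMeasurable]

lemma integrable_sphereLaw {v : E} (hv : v ≠ 0) {f : E → ℝ} (hf : Continuous f) :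
    Integrable f (sphereLaw E) := by
  obtain ⟨C, hC⟩ := (isCompact_sphere (0 : E) 1).exists_bound_of_continuousOn hf.continuousOn
  refine Integrable.of_bound hf.aestronglyMeasurable C ?_
  filter_upwards [sphereLaw_ae_norm hv] with u hu
  exact hC u (by simpa using hu)

/-- The moments of a linear form under the uniform law on the sphere only depend on its norm. -/
lemma integral_inner_pow_sphereLaw {e : E} (he : ‖e‖ = 1) (w : E) (k : ℕ) :
    ∫ u, ⟪w, u⟫_ℝ ^ k ∂sphereLaw E = ‖w‖ ^ k * ∫ u, ⟪e, u⟫_ℝ ^ k ∂sphereLaw E := by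
  have h := Submodule.reflection_sub (F := E) (v := w) (w := ‖w‖ • e) (by simp [norm_smul, he])
  set R := (ℝ ∙ (w - ‖w‖ • e))ᗮ.reflection with hR
  rw [← integral_sphereLaw_comp_isometry R (fun u => ⟪w, u⟫_ℝ ^ k) (by fun_prop),
    ← integral_const_mul]
  congr 1 with u
  have hw : R w = ‖w‖ • e := h
  rw [← mul_pow, ← R.inner_map_map, hw, hR, Submodule.reflection_reflection,
    real_inner_smul_left]

lemma coeff_two_one_add_pow (b c : ℝ) (k : ℕ) :
    ((1 + Polynomial.C b * Polynomial.X + Polynomial.C c * Polynomial.X ^ 2) ^ (k + 1)).coeff 0 = 1 ∧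
    ((1 + Polynomial.C b * Polynomial.X + Polynomial.C c * Polynomial.X ^ 2) ^ (k + 1)).coeff 1
      = (k + 1) * b ∧
    ((1 + Polynomial.C b * Polynomial.X + Polynomial.C c * Polynomial.X ^ 2) ^ (k + 1)).coeff 2
      = (k + 1) * c + (k + 1) * k / 2 * b ^ 2 := by
  induction k with
  | zero => simp [Polynomial.coeff_one, Polynomial.coeff_X, Polynomial.coeff_X_pow]
  | succ k ih =>
    obtain ⟨h0, h1, h2⟩ := ih
    rw [pow_succ]
    simp only [Polynomial.coeff_mul, Finset.Nat.antidiagonal_succ]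
    simp [Polynomial.coeff_one, Polynomial.coeff_X, Polynomial.coeff_X_pow, h0, h1, h2]
    constructor <;> ring

lemma integral_inner_pow_mul_inner_sq {e : E} (he : ‖e‖ = 1) (x : E) (m : ℕ) :
    (2 * m + 1) * ∫ u, ⟪e, u⟫_ℝ ^ (2 * m) * ⟪x, u⟫_ℝ ^ 2 ∂sphereLaw E =
      (‖x‖ ^ 2 + 2 * m * ⟪e, x⟫_ℝ ^ 2) * ∫ u, ⟪e, u⟫_ℝ ^ (2 * (m + 1)) ∂sphereLaw E := by
  have he0 : e ≠ 0 := by rintro rfl; simp at he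
  set a := ∫ u, ⟪e, u⟫_ℝ ^ (2 * (m + 1)) ∂sphereLaw E with ha
  have key : (∑ j ∈ Finset.range (2 * (m + 1) + 1), Polynomial.C
      ((∫ u, ⟪x, u⟫_ℝ ^ j * ⟪e, u⟫_ℝ ^ (2 * (m + 1) - j) ∂sphereLaw E) *
        ((2 * (m + 1)).choose j : ℝ)) * Polynomial.X ^ j) =
      Polynomial.C a * (1 + Polynomial.C (2 * ⟪e, x⟫_ℝ) * Polynomial.X +
        Polynomial.C (‖x‖ ^ 2) * Polynomial.X ^ 2) ^ (m + 1) := by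
    refine Polynomial.funext fun t => ?_
    have h := integral_inner_pow_sphereLaw he (t • x + e) (2 * (m + 1))
    have hn : ‖t • x + e‖ ^ 2 = 1 + 2 * ⟪e, x⟫_ℝ * t + ‖x‖ ^ 2 * t ^ 2 := by
      rw [norm_add_sq_real, norm_smul, he, real_inner_smul_left, mul_pow, Real.norm_eq_abs, sq_abs,
        real_inner_comm]
      ring
    rw [pow_mul ‖t • x + e‖, hn] at h
    conv_lhs at h => simp only [inner_add_left, real_inner_smul_left, add_pow]
    rw [integral_finsetSum _ fun j _ => integrable_sphereLaw he0 (by fun_prop)] at h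
    simp only [Polynomial.eval_finsetSum, Polynomial.eval_mul, Polynomial.eval_C,
      Polynomial.eval_pow, Polynomial.eval_X, Polynomial.eval_add, Polynomial.eval_one]
    rw [mul_comm a, ha, ← h]
    refine Finset.sum_congr rfl fun j _ => ?_
    rw [mul_assoc, ← integral_mul_const]
    congr 1 with u
    ring
  have h2 := congrArg (fun P => Polynomial.coeff P 2) key
  simp only [Polynomial.finsetSum_coeff, Polynomial.coeff_C_mul, Polynomial.coeff_X_pow,
    (coeff_two_one_add_pow (2 * ⟪e, x⟫_ℝ) (‖x‖ ^ 2) m).2.2] at h2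
  rw [Finset.sum_eq_single 2 (fun j _ hj => by simp [hj.symm]) (fun h => by simp at h)] at h2
  have hc : ((2 * (m + 1)).choose 2 : ℝ) = (m + 1) * (2 * m + 1) := by
    rw [Nat.cast_choose_two]; push_cast; ring
  have hm : (m + 1 : ℝ) ≠ 0 := by positivity
  have hsw : (∫ u, ⟪x, u⟫_ℝ ^ 2 * ⟪e, u⟫_ℝ ^ (2 * (m + 1) - 2) ∂sphereLaw E) =
      ∫ u, ⟪e, u⟫_ℝ ^ (2 * m) * ⟪x, u⟫_ℝ ^ 2 ∂sphereLaw E := by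
    congr 1 with u
    rw [mul_comm]; rfl
  rw [hsw, hc] at h2
  simp only [if_true, mul_one] at h2
  apply mul_left_cancel₀ hm
  linear_combination h2

lemma integral_inner_pow_succ {e : E} (he : ‖e‖ = 1) (m : ℕ) :
    (2 * m + 1) * ∫ u, ⟪e, u⟫_ℝ ^ (2 * m) ∂sphereLaw E =
      (2 * m + Module.finrank ℝ E) * ∫ u, ⟪e, u⟫_ℝ ^ (2 * (m + 1)) ∂sphereLaw E := by
  have he0 : e ≠ 0 := by rintro rfl; simp at he
  let b := stdOrthonormalBasis ℝ E
  have h := Finset.sum_congr (s₁ := Finset.univ) rfl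
    fun k _ => integral_inner_pow_mul_inner_sq he (b k) m
  have hs (u : E) : ∑ k, ⟪b k, u⟫_ℝ ^ 2 = ‖u‖ ^ 2 := by
    simpa using b.sum_sq_norm_inner_right u
  have hs' : ∑ k, ⟪e, b k⟫_ℝ ^ 2 = 1 := by
    rw [Finset.sum_congr rfl fun k _ => by rw [real_inner_comm], hs, he, one_pow]
  rw [← Finset.mul_sum, ← integral_finsetSum _ fun k _ => integrable_sphereLaw he0 (by fun_prop),
    ← Finset.sum_mul, Finset.sum_add_distrib, ← Finset.mul_sum, hs'] at h
  have h1 : ∫ u, ∑ k, ⟪e, u⟫_ℝ ^ (2 * m) * ⟪b k, u⟫_ℝ ^ 2 ∂sphereLaw E =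
      ∫ u, ⟪e, u⟫_ℝ ^ (2 * m) ∂sphereLaw E := by
    refine integral_congr_ae ?_
    filter_upwards [sphereLaw_ae_norm he0] with u hu
    rw [← Finset.mul_sum, hs, hu]; simp
  rw [h1] at h
  rw [h]
  simp [b.orthonormal.1]
  left; ring

lemma pow_mul_tangent_le_exp {z y F c : ℝ} (hz : 0 ≤ z) (hy : 0 < y) {m : ℕ} (hm : m ≠ 0) :
    y⁻¹ ^ m * Real.exp c * ((1 - c + m) * z ^ m + F * z ^ m - m / y * z ^ (m + 1)) ≤
      Real.exp F := by
  rcases hz.eq_or_lt with rfl | hz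
  · simp [hm]; positivity
  have h1 : Real.exp F = y⁻¹ ^ m * Real.exp c * z ^ m *
      Real.exp (F - c - m * Real.log (z / y)) := by
    have : Real.exp (m * Real.log (z / y)) = (z / y) ^ m := by
      rw [mul_comm, Real.exp_mul, Real.exp_log (by positivity), Real.rpow_natCast]
    rw [Real.exp_sub, Real.exp_sub, this, div_pow, inv_pow]
    field_simp
  have h2 := Real.add_one_le_exp (F - c - m * Real.log (z / y))
  have h3 : (m : ℝ) * Real.log (z / y) ≤ m * (z / y - 1) :=
    mul_le_mul_of_nonneg_left (Real.log_le_sub_one_of_pos (by positivity)) (by positivity)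
  rw [h1]
  calc _ = y⁻¹ ^ m * Real.exp c * z ^ m * (F - c - m * (z / y - 1) + 1) := by ring
    _ ≤ _ := by gcongr; linarith

/-- Gibbs variational lower bound for the Laplace transform of a quadratic form under the uniform
law of the sphere, compensated by its trace. -/
lemma le_integral_exp_sphereLaw {ι : Type*} (B : Finset ι) (x : ι → E) {e : E} (he : ‖e‖ = 1)
    {m : ℕ} (hm : m ≠ 0) (L : ℝ) :
    (∫ u, ⟪e, u⟫_ℝ ^ (2 * m) ∂sphereLaw E) *
      ((2 * m + Module.finrank ℝ E) / (2 * m + 1)) ^ m *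
      Real.exp (-(L * (2 * m) / (2 * m + Module.finrank ℝ E)) * ∑ i ∈ B, ⟪e, x i⟫_ℝ ^ 2) ≤
    ∫ u, Real.exp (∑ i ∈ B, (-L * ⟪x i, u⟫_ℝ ^ 2 +
      L / (2 * m + Module.finrank ℝ E) * ‖x i‖ ^ 2)) ∂sphereLaw E := by
  have he0 : e ≠ 0 := by rintro rfl; simp at he
  have hcont_int {f : E → ℝ} (hf : Continuous f) := integrable_sphereLaw he0 hf
  set d : ℝ := (Module.finrank ℝ E : ℝ) with hd
  have hd0 : (0 : ℝ) ≤ d := by positivity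
  have hm0 : (0 : ℝ) < 2 * m + d := by positivity
  have hm1 : (0 : ℝ) < 2 * m + 1 := by positivity
  set a := ∫ u, ⟪e, u⟫_ℝ ^ (2 * m) ∂sphereLaw E with ha
  set a' := ∫ u, ⟪e, u⟫_ℝ ^ (2 * (m + 1)) ∂sphereLaw E with ha'
  have haa : (2 * m + 1) * a = (2 * m + d) * a' := integral_inner_pow_succ he m
  set F : E → ℝ := fun u => ∑ i ∈ B, (-L * ⟪x i, u⟫_ℝ ^ 2 + L / (2 * m + d) * ‖x i‖ ^ 2) with hF
  have hFc : Continuous F := by fun_prop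
  set c := -(L * (2 * m) / (2 * m + d)) * ∑ i ∈ B, ⟪e, x i⟫_ℝ ^ 2 with hc
  set y : ℝ := (2 * m + 1) / (2 * m + d) with hy
  have hy0 : 0 < y := by positivity
  have hFint : ∫ u, F u * (⟪e, u⟫_ℝ ^ 2) ^ m ∂sphereLaw E = c * a := by
    simp only [hF, Finset.sum_mul]
    rw [integral_finsetSum _ fun i _ => hcont_int (by fun_prop), hc, Finset.mul_sum, Finset.sum_mul]
    refine Finset.sum_congr rfl fun i _ => ?_
    have h1 := integral_inner_pow_mul_inner_sq he (x i) m
    rw [← ha'] at h1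
    have h2 : ∫ u, (-L * ⟪x i, u⟫_ℝ ^ 2 + L / (2 * m + d) * ‖x i‖ ^ 2) * (⟪e, u⟫_ℝ ^ 2) ^ m
        ∂sphereLaw E = -L * ∫ u, ⟪e, u⟫_ℝ ^ (2 * m) * ⟪x i, u⟫_ℝ ^ 2 ∂sphereLaw E +
          L / (2 * m + d) * ‖x i‖ ^ 2 * a := by
      rw [ha, ← integral_const_mul, ← integral_const_mul,
        ← integral_add (hcont_int (by fun_prop)) (hcont_int (by fun_prop))]
      congr 1 with u
      rw [pow_mul]; ring
    rw [h2]
    set I := ∫ u, ⟪e, u⟫_ℝ ^ (2 * m) * ⟪x i, u⟫_ℝ ^ 2 ∂sphereLaw E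
    have h3 : (2 * m + d) * I = (‖x i‖ ^ 2 + 2 * m * ⟪e, x i⟫_ℝ ^ 2) * a := by
      apply mul_left_cancel₀ hm1.ne'
      linear_combination (2 * m + d) * h1 - (‖x i‖ ^ 2 + 2 * m * ⟪e, x i⟫_ℝ ^ 2) * haa
    field_simp
    linear_combination -L * h3
  have hkey : ∫ u, y⁻¹ ^ m * Real.exp c * ((1 - c + m) * (⟪e, u⟫_ℝ ^ 2) ^ m +
      F u * (⟪e, u⟫_ℝ ^ 2) ^ m - m / y * (⟪e, u⟫_ℝ ^ 2) ^ (m + 1)) ∂sphereLaw E =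
      y⁻¹ ^ m * Real.exp c * a := by
    rw [integral_const_mul, integral_sub (hcont_int (by fun_prop)) (hcont_int (by fun_prop)),
      integral_add (hcont_int (by fun_prop)) (hcont_int (by fun_prop)), hFint, integral_const_mul,
      integral_const_mul]
    simp only [← pow_mul, ← ha, ← ha']
    have : m / y * a' = m * a := by
      rw [hy]; field_simp; linear_combination -haa
    rw [this]; ring
  calc a * ((2 * m + d) / (2 * m + 1)) ^ m * Real.exp c = y⁻¹ ^ m * Real.exp c * a := by
        rw [hy, inv_div]; ring
    _ ≤ ∫ u, Real.exp (F u) ∂sphereLaw E := by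
        rw [← hkey]
        exact integral_mono (hcont_int (by fun_prop)) (hcont_int (by fun_prop)) fun u =>
          pow_mul_tangent_le_exp (sq_nonneg _) hy0 hm

lemma integral_inner_pow_sphereLaw_eq_prod {e : E} (he : ‖e‖ = 1) (m : ℕ) :
    ∫ u, ⟪e, u⟫_ℝ ^ (2 * m) ∂sphereLaw E =
      ∏ k ∈ Finset.range m, ((2 * k + 1 : ℝ) / (2 * k + Module.finrank ℝ E)) := by
  have hd : 0 < Module.finrank ℝ E :=
    Module.finrank_pos_iff_exists_ne_zero.2 ⟨e, by rintro rfl; simp at he⟩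
  induction m with
  | zero => simp
  | succ m ih =>
    have := integral_inner_pow_succ he m
    rw [Finset.prod_range_succ, ← ih, mul_div_assoc', eq_div_iff (by positivity)]
    linear_combination -this

lemma integral_exp_mul_sq_gaussianReal {c : ℝ} (hc : c < 1 / 2) :
    Integrable (fun x => Real.exp (c * x ^ 2)) (gaussianReal 0 1) ∧
      ∫ x, Real.exp (c * x ^ 2) ∂gaussianReal 0 1 = (√(1 - 2 * c))⁻¹ := by
  have h (x : ℝ) : gaussianPDFReal 0 1 x * Real.exp (c * x ^ 2) =
      (√(2 * π))⁻¹ * Real.exp (-(1 / 2 - c) * x ^ 2) := by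
    rw [gaussianPDFReal, mul_assoc, ← Real.exp_add]
    simp only [NNReal.coe_one, mul_one]
    congr 2; ring
  constructor
  · rw [gaussianReal_of_var_ne_zero _ one_ne_zero,
      integrable_withDensity_iff_integrable_smul' (measurable_gaussianPDF _ _)
      (ae_of_all _ fun _ => gaussianPDF_lt_top)]
    simp only [toReal_gaussianPDF, smul_eq_mul, h]
    exact (integrable_exp_neg_mul_sq (by linarith)).const_mul _
  · rw [integral_gaussianReal_eq_integral_smul one_ne_zero]
    simp only [smul_eq_mul, h]
    rw [integral_const_mul, integral_gaussian, ← Real.sqrt_inv, ← Real.sqrt_inv,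
      ← Real.sqrt_mul (by positivity)]
    congr 1
    have : 1 / 2 - c ≠ 0 := by linarith
    have : 1 - 2 * c ≠ 0 := by linarith
    field_simp

/-- Laplace transform of a rank-one quadratic form compensated by the squared norm. -/
lemma integral_exp_inner_sq_stdGaussian {u : E} (hu : ‖u‖ = 1) {L M : ℝ} (hL : 0 ≤ L)
    (hM : M < 1 / 2) :
    Integrable (fun x => Real.exp (-L * ⟪x, u⟫_ℝ ^ 2 + M * ‖x‖ ^ 2)) (stdGaussian E) ∧
    ∫ x, Real.exp (-L * ⟪x, u⟫_ℝ ^ 2 + M * ‖x‖ ^ 2) ∂stdGaussian E =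
      (√(1 + 2 * L - 2 * M))⁻¹ * (√(1 - 2 * M))⁻¹ ^ (Module.finrank ℝ E - 1) := by
  classical
  have hon : Orthonormal ℝ ((↑) : ({u} : Set E) → E) := by
    rw [orthonormal_subtype_iff_ite]
    simp [hu]
  obtain ⟨s, b, hs, hb⟩ := hon.exists_orthonormalBasis_extension
  have hus : u ∈ s := hs rfl
  set i₀ : s := ⟨u, hus⟩ with hi₀
  have hbi : b i₀ = u := by rw [hb]
  have hcomp (x : s → ℝ) : Real.exp (-L * ⟪∑ i, x i • b i, u⟫_ℝ ^ 2 +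
      M * ‖∑ i, x i • b i‖ ^ 2) =
      ∏ i, Real.exp ((M - if i = i₀ then L else 0) * x i ^ 2) := by
    have h1 : ⟪∑ i, x i • b i, u⟫_ℝ = x i₀ := by
      rw [← hbi, b.orthonormal.inner_left_fintype]; simp
    have h2 : ‖∑ i, x i • b i‖ ^ 2 = ∑ i, x i ^ 2 := by
      rw [← real_inner_self_eq_norm_sq, b.orthonormal.inner_sum]
      simp [sq]
    rw [h1, h2, ← Real.exp_sum]
    congr 1
    simp only [sub_mul, Finset.sum_sub_distrib, ← Finset.mul_sum, ite_mul, zero_mul,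
      Finset.sum_ite_eq', Finset.mem_univ, if_true]
    ring
  have hlt (i : s) : (M - if i = i₀ then L else 0) < 1 / 2 := by split_ifs <;> linarith
  have hmeas : AEMeasurable (fun x : s → ℝ => ∑ i, x i • b i)
      (Measure.pi fun _ : s => gaussianReal 0 1) :=
    (by fun_prop : Continuous fun x : s → ℝ => ∑ i, x i • b i).aemeasurable
  have hcont : Continuous (fun x : E => Real.exp (-L * ⟪x, u⟫_ℝ ^ 2 + M * ‖x‖ ^ 2)) := by fun_prop
  rw [stdGaussian_eq_map_pi_orthonormalBasis b]
  constructor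
  · rw [integrable_map_measure hcont.aestronglyMeasurable hmeas]
    simp only [Function.comp_def, hcomp]
    exact Integrable.fintype_prod_dep fun i => (integral_exp_mul_sq_gaussianReal (hlt i)).1
  · rw [integral_map hmeas hcont.aestronglyMeasurable]
    simp only [hcomp]
    rw [integral_fintype_prod_eq_prod (fun (i : s) (x : ℝ) =>
      Real.exp ((M - if i = i₀ then L else 0) * x ^ 2))]
    simp only [(integral_exp_mul_sq_gaussianReal (hlt _)).2]
    rw [← Finset.mul_prod_erase _ _ (Finset.mem_univ i₀)]
    congr 1
    · simp only [if_true]; congr 2; ring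
    · rw [Finset.prod_congr rfl (g := fun _ => (√(1 - 2 * M))⁻¹)]
      · rw [Finset.prod_const, Finset.card_erase_of_mem (Finset.mem_univ _),
          Module.finrank_eq_card_basis b.toBasis, Finset.card_univ]
      · intro i hi
        simp [(Finset.mem_erase.1 hi).1]

end SphereLaw

section CompensatedLaplace

variable {ι E : Type*} [NormedAddCommGroup E] [InnerProductSpace ℝ E] [FiniteDimensional ℝ E]
  [MeasurableSpace E] [BorelSpace E]

open scoped InnerProductSpace

/-- The sphere average of the exponential of `-L ∑ ⟪y i, u⟫² + M ∑ ‖y i‖²`. -/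
noncomputable def compensatedLaplace (L M : ℝ) (B : Finset ι) (y : ι → E) : ENNReal :=
  ∫⁻ u, ENNReal.ofReal (Real.exp (∑ i ∈ B, (-L * ⟪y i, u⟫_ℝ ^ 2 + M * ‖y i‖ ^ 2))) ∂sphereLaw E

lemma measurable_compensatedLaplace [Countable ι] (L M : ℝ) (B : Finset ι) :
    Measurable (compensatedLaplace L M B : (ι → E) → ENNReal) := by
  refine Measurable.lintegral_prod_right' (f := fun z : (ι → E) × E => ENNReal.ofReal
    (Real.exp (∑ i ∈ B, (-L * ⟪z.1 i, z.2⟫_ℝ ^ 2 + M * ‖z.1 i‖ ^ 2)))) ?_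
  fun_prop

lemma lintegral_compensatedLaplace [Fintype ι] {v : E} (hv : v ≠ 0) {L M : ℝ} (hL : 0 ≤ L)
    (hM : M < 1 / 2) (B : Finset ι) :
    ∫⁻ y, compensatedLaplace L M B y ∂(Measure.pi fun _ : ι => stdGaussian E) =
      ENNReal.ofReal (((√(1 + 2 * L - 2 * M))⁻¹ *
        (√(1 - 2 * M))⁻¹ ^ (Module.finrank ℝ E - 1)) ^ B.card) := by
  classical
  have hmeas : Measurable fun z : (ι → E) × E => ENNReal.ofReal
    (Real.exp (∑ i ∈ B, (-L * ⟪z.1 i, z.2⟫_ℝ ^ 2 + M * ‖z.1 i‖ ^ 2))) := by fun_prop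
  simp only [compensatedLaplace]
  rw [lintegral_lintegral_swap hmeas.aemeasurable]
  have key : ∀ᵐ u ∂sphereLaw E, ∫⁻ y, ENNReal.ofReal (Real.exp (∑ i ∈ B,
      (-L * ⟪y i, u⟫_ℝ ^ 2 + M * ‖y i‖ ^ 2))) ∂(Measure.pi fun _ : ι => stdGaussian E) =
      ENNReal.ofReal (((√(1 + 2 * L - 2 * M))⁻¹ *
        (√(1 - 2 * M))⁻¹ ^ (Module.finrank ℝ E - 1)) ^ B.card) := by
    filter_upwards [sphereLaw_ae_norm hv] with u hu
    obtain ⟨hi, he⟩ := integral_exp_inner_sq_stdGaussian hu hL hM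
    set f : ι → E → ℝ := fun i x => if i ∈ B then
      Real.exp (-L * ⟪x, u⟫_ℝ ^ 2 + M * ‖x‖ ^ 2) else 1 with hf
    have hfi (i : ι) : Integrable (f i) (stdGaussian E) := by
      by_cases h : i ∈ B
      · simpa [hf, h] using hi
      · simp [hf, h]
    have hprod (y : ι → E) : Real.exp (∑ i ∈ B, (-L * ⟪y i, u⟫_ℝ ^ 2 + M * ‖y i‖ ^ 2)) =
        ∏ i, f i (y i) := by
      rw [Real.exp_sum]
      simp [hf, Finset.prod_ite_mem]
    simp only [hprod]
    rw [← ofReal_integral_eq_lintegral_ofReal (Integrable.fintype_prod_dep hfi)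
      (ae_of_all _ fun y => by simp only [Pi.zero_apply, ← hprod]; positivity),
      integral_fintype_prod_eq_prod]
    congr 1
    have hfint (i : ι) : ∫ x, f i x ∂stdGaussian E = if i ∈ B then ((√(1 + 2 * L - 2 * M))⁻¹ *
        (√(1 - 2 * M))⁻¹ ^ (Module.finrank ℝ E - 1)) else 1 := by
      split_ifs with h
      · simpa [hf, h] using he
      · simp [hf, h]
    simp only [hfint]
    simp [Finset.prod_ite_mem]
  rw [lintegral_congr_ae key]
  simp

lemma le_compensatedLaplace {B : Finset ι} {y : ι → E} {e : E} (he : ‖e‖ = 1) {m : ℕ} (hm : m ≠ 0)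
    {l t : ℝ} (hl : 0 ≤ l) (ht : ∑ i ∈ B, ⟪e, y i⟫_ℝ ^ 2 ≤ t) :
    ENNReal.ofReal ((∏ k ∈ Finset.range m, ((2 * k + 1 : ℝ) / (2 * k + Module.finrank ℝ E))) *
      ((2 * m + Module.finrank ℝ E) / (2 * m + 1)) ^ m * Real.exp (-l * t)) ≤
    compensatedLaplace (l * (2 * m + Module.finrank ℝ E) / (2 * m)) (l / (2 * m)) B y := by
  have h := le_integral_exp_sphereLaw B y he hm (l * (2 * m + Module.finrank ℝ E) / (2 * m))
  have hm0 : (0 : ℝ) < m := by positivity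
  have he0 : e ≠ 0 := by rintro rfl; simp at he
  rw [compensatedLaplace, ← ofReal_integral_eq_lintegral_ofReal
    (integrable_sphereLaw he0 (by fun_prop)) (ae_of_all _ fun y => by simp; positivity)]
  apply ENNReal.ofReal_le_ofReal
  rw [integral_inner_pow_sphereLaw_eq_prod he] at h
  have h1 : l * (2 * m + Module.finrank ℝ E) / (2 * m) / (2 * m + Module.finrank ℝ E) =
      l / (2 * m) := by field_simp
  have h2 : l * (2 * m + Module.finrank ℝ E) / (2 * m) * (2 * m) / (2 * m + Module.finrank ℝ E) =
      l := by field_simp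
  rw [h1, h2] at h
  refine le_trans ?_ h
  have h3 := mul_le_mul_of_nonneg_left ht hl
  gcongr ?_ * Real.exp ?_
  linarith

end CompensatedLaplace

lemma map_toLp_restrict_pi_gaussianReal {p : ℕ} (S : Finset (Fin p)) :
    (Measure.pi fun _ : Fin p => gaussianReal 0 1).map
      (fun x => (WithLp.toLp 2 fun j : S => x j : EuclideanSpace ℝ S)) =
      stdGaussian (EuclideanSpace ℝ S) := by
  have h := Measure.infinitePi_map_restrict (fun _ : Fin p => gaussianReal 0 1) (I := S)
  rw [Measure.infinitePi_eq_pi] at h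
  rw [← map_pi_eq_stdGaussian, ← h, Measure.map_map (by fun_prop) (by fun_prop)]
  rfl

lemma map_toLp_restrict_gaussMat {n p : ℕ} (S : Finset (Fin p)) :
    (gaussMat n p).map
      (fun x i => (WithLp.toLp 2 fun j : S => x i j : EuclideanSpace ℝ S)) =
      Measure.pi fun _ : Fin n => stdGaussian (EuclideanSpace ℝ S) := by
  have (i : Fin n) : SigmaFinite ((Measure.pi fun _ : Fin p => gaussianReal 0 1).map
      (fun x => (WithLp.toLp 2 fun j : S => x j : EuclideanSpace ℝ S))) := by
    rw [map_toLp_restrict_pi_gaussianReal]; infer_instance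
  rw [gaussMat, Measure.pi_map_pi (f := fun _ (x : Fin p → ℝ) =>
    (WithLp.toLp 2 fun j : S => x j : EuclideanSpace ℝ S)) (fun i =>
      ((PiLp.continuous_toLp 2 _).comp (by fun_prop)).aemeasurable)]
  simp only [map_toLp_restrict_pi_gaussianReal]

instance (n p : ℕ) : IsProbabilityMeasure (gaussMat n p) := by
  unfold gaussMat; infer_instance

/-- Negation of the rows with index in `F`. -/
def flipRows {n p : ℕ} (F : Finset (Fin n)) (x : Fin n → Fin p → ℝ) : Fin n → Fin p → ℝ :=
  fun i => if i ∈ F then -x i else x i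

lemma measure_flipRows_preimage {n p : ℕ} (F : Finset (Fin n)) (T : Set (Fin n → Fin p → ℝ)) :
    gaussMat n p (flipRows F ⁻¹' T) = gaussMat n p T := by
  have hinv : Function.Involutive (flipRows F : (Fin n → Fin p → ℝ) → _) := by
    intro x; ext i j
    by_cases h : i ∈ F <;> simp [flipRows, h]
  have hneg : MeasurePreserving (fun x : Fin p → ℝ => -x)
      (Measure.pi fun _ : Fin p => gaussianReal 0 1)
      (Measure.pi fun _ : Fin p => gaussianReal 0 1) :=
    measurePreserving_pi (fun _ => gaussianReal 0 1) (fun _ => gaussianReal 0 1)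
      (f := fun _ x => -x) fun _ => ⟨measurable_neg, by rw [gaussianReal_map_neg, neg_zero]⟩
  have hpres : MeasurePreserving (flipRows F) (gaussMat n p) (gaussMat n p) := by
    refine measurePreserving_pi _ _ (f := fun i (x : Fin p → ℝ) => if i ∈ F then -x else x)
      fun i => ?_
    by_cases h : i ∈ F
    · simpa [h] using hneg
    · simp only [h, if_false]; exact MeasurePreserving.id _
  exact MeasurePreserving.measure_preimage_equiv
    (f := MeasurableEquiv.ofInvolutive _ hinv hpres.measurable) hpres T

/-- The rows on which the linear form `θ` is nonnegative. -/
noncomputable def posRows {n p : ℕ} (θ : Fin p → ℝ) (x : Fin n → Fin p → ℝ) : Finset (Fin n) :=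
  Finset.univ.filter fun i => 0 ≤ ∑ j, x i j * θ j

lemma symmDiff_posRows_subset {n p : ℕ} (θ : Fin p → ℝ) (F : Finset (Fin n))
    (x : Fin n → Fin p → ℝ) : symmDiff F (posRows θ x) ⊆ posRows θ (flipRows F x) := by
  intro i hi
  simp only [Finset.mem_symmDiff, posRows, Finset.mem_filter, Finset.mem_univ, true_and,
    not_le] at hi ⊢
  rcases hi with ⟨h1, h2⟩ | ⟨h1, h2⟩
  · simp only [flipRows, h1, if_true, Pi.neg_apply, neg_mul, Finset.sum_neg_distrib]; linarith
  · simpa [flipRows, h2] using h1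

lemma measurableSet_posRows_eq {n p : ℕ} (θ : Fin p → ℝ) (B : Finset (Fin n)) :
    MeasurableSet {x : Fin n → Fin p → ℝ | posRows θ x = B} := by
  have : {x : Fin n → Fin p → ℝ | posRows θ x = B} =
      ⋂ i, {x : Fin n → Fin p → ℝ | (0 ≤ ∑ j, x i j * θ j) ↔ i ∈ B} := by
    ext x
    simp [posRows, Finset.ext_iff]
  rw [this]
  refine MeasurableSet.iInter fun i => ?_
  by_cases h : i ∈ B
  · simp only [h, iff_true]; exact measurableSet_le measurable_const (by fun_prop)
  · simp only [h, iff_false, not_le]; exact measurableSet_lt (by fun_prop) measurable_const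

/-- Symmetrization: if the events `T B` are antitone in the set `B` of active rows and invariant
under row sign flips, then the random set `posRows θ x` may be replaced by a uniform one. -/
lemma two_pow_mul_measure_posRows_le {n p : ℕ} (θ : Fin p → ℝ)
    {T A : Finset (Fin n) → Set (Fin n → Fin p → ℝ)} (hT : Antitone T)
    (hflip : ∀ F B x, flipRows F x ∈ T B → x ∈ T B) (hTA : ∀ B, T B ⊆ A B) :
    2 ^ n * gaussMat n p {x | x ∈ T (posRows θ x)} ≤ ∑ B, gaussMat n p (A B) := by
  have h1 (F : Finset (Fin n)) : gaussMat n p {x | x ∈ T (posRows θ x)} ≤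
      ∑ B, gaussMat n p (A B ∩ {x | posRows θ x = symmDiff F B}) := by
    rw [← measure_flipRows_preimage F]
    refine le_trans (measure_mono ?_) (measure_biUnion_finset_le _ _)
    intro x hx
    have hx' : x ∈ T (symmDiff F (posRows θ x)) :=
      hT (symmDiff_posRows_subset θ F x) (hflip F _ x hx)
    simp only [Set.mem_iUnion]
    exact ⟨_, Finset.mem_univ _, hTA _ hx', by simp⟩
  have h2 (B : Finset (Fin n)) :
      ∑ F, gaussMat n p (A B ∩ {x | posRows θ x = symmDiff F B}) = gaussMat n p (A B) := by
    have := sum_measure_preimage_singleton (μ := (gaussMat n p).restrict (A B))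
      (Finset.univ : Finset (Finset (Fin n))) (f := posRows θ)
      (fun B' _ => measurableSet_posRows_eq θ B')
    simp only [Finset.coe_univ, Set.preimage_univ, Measure.restrict_apply_univ] at this
    rw [← this]
    refine Fintype.sum_equiv (symmDiff_right_involutive B).toPerm _ _ fun F => ?_
    rw [Measure.restrict_apply (s := A B) (t := posRows θ ⁻¹' {_})
      (measurableSet_posRows_eq θ _), Set.inter_comm]
    congr 2
    ext x
    simp [symmDiff_comm]
  calc 2 ^ n * gaussMat n p {x | x ∈ T (posRows θ x)}
      = ∑ F : Finset (Fin n), gaussMat n p {x | x ∈ T (posRows θ x)} := by simp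
    _ ≤ ∑ F, ∑ B, gaussMat n p (A B ∩ {x | posRows θ x = symmDiff F B}) :=
        Finset.sum_le_sum fun F _ => h1 F
    _ = ∑ B, gaussMat n p (A B) := by
        rw [Finset.sum_comm]; exact Finset.sum_congr rfl fun B _ => h2 B

lemma exists_lamMin_eq {m : Type*} [Fintype m] [Nonempty m] (A : Matrix m m ℝ) :
    ∃ u : m → ℝ, (∑ i, u i ^ 2) = 1 ∧ lamMin A = u ⬝ᵥ A.mulVec u := by
  classical
  have hset : {r : ℝ | ∃ u : m → ℝ, (∑ i, u i ^ 2) = 1 ∧ r = u ⬝ᵥ A.mulVec u} =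
      (fun u : EuclideanSpace ℝ m => u.ofLp ⬝ᵥ A.mulVec u.ofLp) '' Metric.sphere 0 1 := by
    ext r
    constructor
    · rintro ⟨u, hu, rfl⟩
      refine ⟨WithLp.toLp 2 u, ?_, rfl⟩
      simp [EuclideanSpace.norm_eq, hu]
    · rintro ⟨u, hu, rfl⟩
      refine ⟨u.ofLp, ?_, rfl⟩
      have : ‖u‖ = 1 := by simpa using hu
      rw [← EuclideanSpace.real_norm_sq_eq, this, one_pow]
  have hcomp : IsCompact {r : ℝ | ∃ u : m → ℝ, (∑ i, u i ^ 2) = 1 ∧ r = u ⬝ᵥ A.mulVec u} := by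
    rw [hset]
    refine (isCompact_sphere _ _).image ?_
    simp only [dotProduct, mulVec]
    fun_prop
  refine hcomp.sInf_mem ?_
  rw [hset]
  exact (NormedSpace.sphere_nonempty.2 zero_le_one).image _

lemma dotProduct_gramW_mulVec {n p : ℕ} (S : Finset (Fin p)) (w : Fin n → ℝ)
    (x : Fin n → Fin p → ℝ) (u : S → ℝ) :
    u ⬝ᵥ (gramW S w x).mulVec u = ∑ i, w i * (∑ j : S, u j * x i j) ^ 2 := by
  simp only [dotProduct, mulVec, gramW, of_apply, sq, Finset.sum_mul, Finset.mul_sum]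
  rw [Finset.sum_congr rfl fun j _ => Finset.sum_comm, Finset.sum_comm]
  refine Finset.sum_congr rfl fun i _ => ?_
  rw [Finset.sum_comm]
  refine Finset.sum_congr rfl fun j _ => Finset.sum_congr rfl fun k _ => ?_
  ring

/-- The restriction to the coordinates in `S`, as a Euclidean vector. -/
noncomputable def restrictL2 {p : ℕ} (S : Finset (Fin p)) (x : Fin p → ℝ) : EuclideanSpace ℝ S :=
  WithLp.toLp 2 fun j : S => x j

/-- The event that the unweighted Gram matrix of the rows in `B` has a small quadratic form
on some support of size `s`. -/
def smallGram (n p s : ℕ) (t : ℝ) (B : Finset (Fin n)) : Set (Fin n → Fin p → ℝ) :=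
  {x | ∃ S : Finset (Fin p), S.card = s ∧ ∃ v : EuclideanSpace ℝ S, ‖v‖ = 1 ∧
    ∑ i ∈ B, inner ℝ v (restrictL2 S (x i)) ^ 2 ≤ t}

lemma antitone_smallGram (n p s : ℕ) (t : ℝ) : Antitone (smallGram n p s t) := by
  rintro B B' hB x ⟨S, hS, v, hv, h⟩
  exact ⟨S, hS, v, hv, le_trans
    (Finset.sum_le_sum_of_subset_of_nonneg hB fun _ _ _ => sq_nonneg _) h⟩

lemma mem_smallGram_of_flipRows {n p s : ℕ} {t : ℝ} (F B : Finset (Fin n))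
    (x : Fin n → Fin p → ℝ) (h : flipRows F x ∈ smallGram n p s t B) :
    x ∈ smallGram n p s t B := by
  obtain ⟨S, hS, v, hv, h⟩ := h
  refine ⟨S, hS, v, hv, le_of_eq_of_le (Finset.sum_congr rfl fun i _ => ?_) h⟩
  by_cases hi : i ∈ F
  · have : restrictL2 S (flipRows F x i) = -restrictL2 S (x i) := by
      ext j; simp [restrictL2, flipRows, hi]
    rw [this, inner_neg_right, neg_sq]
  · simp [flipRows, hi]

lemma mem_smallGram_of_lamMin_le {n p s : ℕ} (hsp : s ≤ p) (θ : Fin p → ℝ) {t : ℝ}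
    {x : Fin n → Fin p → ℝ} {S : Finset (Fin p)} (hS : S.Nonempty) (hSs : S.card ≤ s)
    (h : lamMin (gramW S (fun i => Real.exp (∑ j, x i j * θ j)) x) ≤ t) :
    x ∈ smallGram n p s t (posRows θ x) := by
  have : Nonempty S := hS.to_subtype
  obtain ⟨u, hu, hlam⟩ := exists_lamMin_eq (gramW S (fun i => Real.exp (∑ j, x i j * θ j)) x)
  rw [hlam, dotProduct_gramW_mulVec] at h
  obtain ⟨S', hSS', hS'⟩ := Finset.exists_superset_card_eq hSs (by simpa using hsp)
  set g : Fin p → ℝ := fun j => if hj : j ∈ S then u ⟨j, hj⟩ else 0 with hg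
  have hgS (j : S) : g j = u j := by simp [hg]
  have hgS' (j : Fin p) (hj : j ∉ S) : g j = 0 := by simp [hg, hj]
  have hsum (f : Fin p → ℝ) (hf : ∀ j ∉ S, f j = 0) : ∑ j : S', f j = ∑ j : S, f j := by
    rw [Finset.sum_coe_sort S' f, Finset.sum_coe_sort S f]
    exact (Finset.sum_subset hSS' fun j _ hj => hf j hj).symm
  refine ⟨S', hS', WithLp.toLp 2 fun j : S' => g j, ?_, le_trans ?_ h⟩
  · rw [← sq_eq_sq₀ (norm_nonneg _) zero_le_one, EuclideanSpace.real_norm_sq_eq, one_pow, ← hu]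
    simp only [← hgS]
    exact hsum (fun j => g j ^ 2) fun j hj => by simp [hgS' j hj]
  · have hinner (i : Fin n) : inner ℝ (WithLp.toLp 2 fun j : S' => g j : EuclideanSpace ℝ S')
        (restrictL2 S' (x i)) = ∑ j : S, u j * x i j := by
      simp only [← hgS]
      rw [← hsum (fun j => g j * x i j) fun j hj => by simp [hgS' j hj]]
      simp [PiLp.inner_apply, restrictL2, mul_comm]
    simp only [hinner]
    refine le_trans (Finset.sum_le_sum fun i hi => ?_)
      (Finset.sum_le_sum_of_subset_of_nonneg (Finset.subset_univ (posRows θ x))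
        fun i _ _ => by positivity)
    have hi' : 0 ≤ ∑ j, x i j * θ j := by simpa [posRows] using hi
    exact le_mul_of_one_le_left (sq_nonneg _) (Real.one_le_exp hi')

/-- The event of a large compensated Laplace transform on some support of size `s`. -/
def largeLaplace (n p s : ℕ) (L M κ : ℝ) (B : Finset (Fin n)) : Set (Fin n → Fin p → ℝ) :=
  ⋃ S ∈ Finset.powersetCard s Finset.univ,
    {x | ENNReal.ofReal κ ≤ compensatedLaplace L M B fun i => restrictL2 S (x i)}

lemma smallGram_subset_largeLaplace {n p s m : ℕ} (hm : m ≠ 0) {l t : ℝ} (hl : 0 ≤ l)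
    (B : Finset (Fin n)) :
    smallGram n p s t B ⊆ largeLaplace n p s (l * (2 * m + s) / (2 * m)) (l / (2 * m))
      ((∏ k ∈ Finset.range m, ((2 * k + 1 : ℝ) / (2 * k + s))) *
        ((2 * m + s) / (2 * m + 1)) ^ m * Real.exp (-l * t)) B := by
  rintro x ⟨S, rfl, v, hv, h⟩
  have hfin : Module.finrank ℝ (EuclideanSpace ℝ S) = S.card := by simp
  have := le_compensatedLaplace hv hm hl h
  rw [hfin] at this
  simp only [largeLaplace, Set.mem_iUnion]
  exact ⟨S, by simp, this⟩

lemma measureReal_largeLaplace_le {n p s : ℕ} (hs : 1 ≤ s) {L M κ : ℝ} (hL : 0 ≤ L)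
    (hM : M < 1 / 2) (hκ : 0 < κ) (B : Finset (Fin n)) :
    (gaussMat n p).real (largeLaplace n p s L M κ B) ≤ p.choose s * κ⁻¹ *
      ((√(1 + 2 * L - 2 * M))⁻¹ * (√(1 - 2 * M))⁻¹ ^ (s - 1)) ^ B.card := by
  set β := (√(1 + 2 * L - 2 * M))⁻¹ * (√(1 - 2 * M))⁻¹ ^ (s - 1) with hβ
  have hβ0 : 0 ≤ β := by positivity
  refine ENNReal.toReal_le_of_le_ofReal (by positivity) ?_
  have hbound (S : Finset (Fin p)) (hS : S ∈ Finset.powersetCard s Finset.univ) :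
      gaussMat n p {x | ENNReal.ofReal κ ≤ compensatedLaplace L M B fun i => restrictL2 S (x i)} ≤
        ENNReal.ofReal (κ⁻¹ * β ^ B.card) := by
    obtain ⟨-, rfl⟩ := Finset.mem_powersetCard.1 hS
    have hmr : Measurable fun (x : Fin n → Fin p → ℝ) i => restrictL2 S (x i) := by
      refine measurable_pi_lambda _ fun i => ?_
      exact ((PiLp.continuous_toLp 2 _).comp (by fun_prop)).measurable
    have hmc := measurable_compensatedLaplace (E := EuclideanSpace ℝ S) L M B
    obtain ⟨j, hj⟩ := Finset.card_pos.1 hs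
    have hv : EuclideanSpace.single (⟨j, hj⟩ : S) (1 : ℝ) ≠ 0 := by simp
    refine (meas_ge_le_lintegral_div (hmc.comp hmr).aemeasurable (by simpa using hκ)
      ENNReal.ofReal_ne_top).trans_eq ?_
    have h := lintegral_map (μ := gaussMat n p) hmc hmr
    have hlaw : (gaussMat n p).map (fun x i => restrictL2 S (x i)) =
      Measure.pi fun _ : Fin n => stdGaussian (EuclideanSpace ℝ S) := map_toLp_restrict_gaussMat S
    rw [hlaw, lintegral_compensatedLaplace hv hL hM] at h
    simp only [Function.comp_def]
    rw [← h, finrank_euclideanSpace, Fintype.card_coe, ← hβ,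
      ← ENNReal.ofReal_div_of_pos hκ, div_eq_inv_mul]
  refine (measure_biUnion_finset_le _ _).trans ((Finset.sum_le_sum hbound).trans_eq ?_)
  rw [Finset.sum_const, Finset.card_powersetCard, Finset.card_univ, Fintype.card_fin,
    nsmul_eq_mul, mul_assoc, ENNReal.ofReal_mul (p := (p.choose s : ℝ)) (by positivity),
    ENNReal.ofReal_natCast]

lemma measureReal_exists_lamMin_le {n p s m : ℕ} (hs : 1 ≤ s) (hsp : s ≤ p) (hm : m ≠ 0)
    (θ : Fin p → ℝ) {l t : ℝ} (hl : 0 ≤ l) (hlm : l / (2 * m) < 1 / 2) :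
    (gaussMat n p).real {x | ∃ S : Finset (Fin p), S.Nonempty ∧ S.card ≤ s ∧
      lamMin (gramW S (fun i => Real.exp (∑ j, x i j * θ j)) x) ≤ t} ≤
    √(p.choose s * ((∏ k ∈ Finset.range m, ((2 * k + 1 : ℝ) / (2 * k + s))) *
        ((2 * m + s) / (2 * m + 1)) ^ m * Real.exp (-l * t))⁻¹) *
      ((1 + √((√(1 + 2 * (l * (2 * m + s) / (2 * m)) - 2 * (l / (2 * m))))⁻¹ *
        (√(1 - 2 * (l / (2 * m))))⁻¹ ^ (s - 1))) / 2) ^ n := by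
  set κ := (∏ k ∈ Finset.range m, ((2 * k + 1 : ℝ) / (2 * k + s))) *
        ((2 * m + s) / (2 * m + 1)) ^ m * Real.exp (-l * t) with hκ
  have hκ0 : 0 < κ := by
    have : 0 < ∏ k ∈ Finset.range m, ((2 * k + 1 : ℝ) / (2 * k + s)) :=
      Finset.prod_pos fun k _ => by positivity
    positivity
  set L := l * (2 * m + s) / (2 * m) with hL
  have hL0 : 0 ≤ L := by positivity
  set M := l / (2 * m) with hM
  set β := (√(1 + 2 * L - 2 * M))⁻¹ * (√(1 - 2 * M))⁻¹ ^ (s - 1) with hβ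
  have hβ0 : 0 ≤ β := by positivity
  have h1 : 2 ^ n * gaussMat n p {x | ∃ S : Finset (Fin p), S.Nonempty ∧ S.card ≤ s ∧
      lamMin (gramW S (fun i => Real.exp (∑ j, x i j * θ j)) x) ≤ t} ≤
      ∑ B, gaussMat n p (largeLaplace n p s L M κ B) := by
    refine le_trans ?_ (two_pow_mul_measure_posRows_le θ (antitone_smallGram n p s t)
      mem_smallGram_of_flipRows fun B => smallGram_subset_largeLaplace hm hl B)
    gcongr
    rintro ⟨S, hS, hSs, h⟩
    exact mem_smallGram_of_lamMin_le hsp θ hS hSs h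
  have h2 := ENNReal.toReal_mono (by simp) h1
  rw [ENNReal.toReal_mul, ENNReal.toReal_sum (by simp)] at h2
  simp only [ENNReal.toReal_pow, ENNReal.toReal_ofNat] at h2
  have h3 (B : Finset (Fin n)) : (gaussMat n p (largeLaplace n p s L M κ B)).toReal ≤
      √(p.choose s * κ⁻¹) * √β ^ B.card := by
    have ha := measureReal_largeLaplace_le (n := n) (p := p) hs hL0 hlm hκ0 B
    have hb : (gaussMat n p).real (largeLaplace n p s L M κ B) ≤ 1 := measureReal_le_one
    have hc : 0 ≤ (gaussMat n p).real (largeLaplace n p s L M κ B) := measureReal_nonneg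
    have hd : √β ^ B.card = √(β ^ B.card) := by
      rw [Real.sqrt_eq_rpow, Real.sqrt_eq_rpow, ← Real.rpow_natCast, ← Real.rpow_natCast,
        ← Real.rpow_mul hβ0, ← Real.rpow_mul hβ0, mul_comm]
    rw [hd, ← Real.sqrt_mul (by positivity)]
    refine Real.le_sqrt_of_sq_le (le_trans ?_ ha)
    exact pow_le_of_le_one hc hb two_ne_zero
  have h4 := h2.trans (Finset.sum_le_sum fun B _ => h3 B)
  have h5 := Fintype.sum_pow_mul_eq_add_pow (Fin n) (√β) (1 : ℝ)
  simp only [one_pow, mul_one, Fintype.card_fin] at h5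
  rw [← Finset.mul_sum, h5, add_comm] at h4
  rw [div_pow, mul_div_assoc', le_div_iff₀ (by positivity), mul_comm]
  exact h4

/-- The inverse of the moment of order `2 * m` of a coordinate on the sphere of `ℝ^s`, normalized. -/
noncomputable def inverseMoment (m : ℕ) (s : ℝ) : ℝ :=
  (∏ k ∈ Finset.range m, ((2 * k + s) / (2 * k + 1))) * ((2 * m + 1) / (2 * m + s)) ^ m

lemma inverseMoment_pos (m : ℕ) {s : ℝ} (hs : 0 < s) : 0 < inverseMoment m s := by
  have : 0 < ∏ k ∈ Finset.range m, ((2 * k + s) / (2 * k + 1)) :=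
    Finset.prod_pos fun k _ => by positivity
  unfold inverseMoment; positivity

lemma inverseMoment_one (m : ℕ) : inverseMoment m 1 = 1 := by
  unfold inverseMoment
  rw [Finset.prod_eq_one fun k _ => div_self (by positivity), div_self (by positivity)]
  simp

lemma inverseMoment_add_two_le (m : ℕ) {s : ℝ} (hs : 0 < s) :
    inverseMoment m (s + 2) ≤
      inverseMoment m s * ((2 * m + s) / s) * Real.exp (-(2 * m / (2 * m + s + 2))) := by
  have hprod : ∏ k ∈ Finset.range m, ((2 * k + (s + 2)) / (2 * k + 1)) =
      (∏ k ∈ Finset.range m, ((2 * k + s) / (2 * k + 1))) * ((2 * m + s) / s) := by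
    induction m with
    | zero => simp [hs.ne']
    | succ m ih =>
      rw [Finset.prod_range_succ, Finset.prod_range_succ, ih]
      push_cast
      field_simp
      ring
  have hexp : ((2 * m + s) / (2 * m + s + 2)) ^ m ≤ Real.exp (-(2 * m / (2 * m + s + 2))) := by
    have h := Real.add_one_le_exp (-(2 / (2 * m + s + 2)))
    calc ((2 * m + s) / (2 * m + s + 2)) ^ m ≤ Real.exp (-(2 / (2 * m + s + 2))) ^ m := by
          gcongr
          refine le_trans (le_of_eq ?_) h
          field_simp; ring
      _ = _ := by rw [← Real.exp_nat_mul]; congr 1; ring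
  have hP : 0 < ∏ k ∈ Finset.range m, ((2 * k + s) / (2 * k + 1)) :=
    Finset.prod_pos fun k _ => by positivity
  have hsplit : ((2 * m + 1) / (2 * m + (s + 2))) ^ m = ((2 * m + 1) / (2 * m + s)) ^ m *
      ((2 * m + s) / (2 * m + s + 2)) ^ m := by
    rw [← mul_pow]; congr 1; field_simp; ring
  unfold inverseMoment
  rw [hprod, hsplit]
  calc _ = (∏ k ∈ Finset.range m, ((2 * k + s) / (2 * k + 1))) *
        ((2 * m + 1) / (2 * m + s)) ^ m * ((2 * m + s) / s) *
        ((2 * m + s) / (2 * m + s + 2)) ^ m := by ring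
    _ ≤ _ := by gcongr

lemma inverseMoment_two_sq_le {m : ℕ} (hm : m ≠ 0) :
    inverseMoment m 2 ^ 2 ≤ 8 / 5 * (2 * m) * Real.exp (-1 + 3 / (2 * m)) := by
  have hm1 : (1 : ℝ) ≤ m := by exact_mod_cast Nat.one_le_iff_ne_zero.2 hm
  have hprod : (∏ k ∈ Finset.range m, ((2 * k + 2 : ℝ) / (2 * k + 1))) ^ 2 ≤
      16 / 5 * (m + 1 / 4) := by
    clear hm1
    induction m, Nat.one_le_iff_ne_zero.2 hm using Nat.le_induction with
    | base => norm_num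
    | succ m hm1 ih =>
      rw [Finset.prod_range_succ, mul_pow]
      refine (mul_le_mul_of_nonneg_right (ih (by lia)) (by positivity)).trans ?_
      rw [div_pow, mul_div_assoc', div_le_iff₀ (by positivity)]
      push_cast
      nlinarith
  have hpow : (((2 * m + 1 : ℝ) / (2 * m + 2)) ^ m) ^ 2 ≤ Real.exp (-(2 * m / (2 * m + 2))) := by
    have h := Real.add_one_le_exp (-(1 / (2 * m + 2 : ℝ)))
    calc (((2 * m + 1 : ℝ) / (2 * m + 2)) ^ m) ^ 2 ≤ (Real.exp (-(1 / (2 * m + 2 : ℝ))) ^ m) ^ 2 := by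
          gcongr
          refine le_trans (le_of_eq ?_) h
          field_simp; ring
      _ = _ := by
        rw [← pow_mul, ← Real.exp_nat_mul]; congr 1; push_cast; ring
  have hlin : (m + 1 / 4 : ℝ) ≤ m * Real.exp (1 / (4 * m)) := by
    have h := mul_le_mul_of_nonneg_left (Real.add_one_le_exp (1 / (4 * m : ℝ)))
      (by positivity : (0 : ℝ) ≤ m)
    refine le_trans (le_of_eq ?_) h
    field_simp
    ring
  unfold inverseMoment
  rw [mul_pow]
  calc _ ≤ 16 / 5 * (m + 1 / 4) * Real.exp (-(2 * m / (2 * m + 2))) := by gcongr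
    _ ≤ 16 / 5 * (m * Real.exp (1 / (4 * m))) * Real.exp (-(2 * m / (2 * m + 2))) := by gcongr
    _ = 8 / 5 * (2 * m) * Real.exp (1 / (4 * m) - 2 * m / (2 * m + 2)) := by
        rw [sub_eq_add_neg, Real.exp_add]; ring
    _ ≤ _ := by
        gcongr
        have h1 : 2 * m / (2 * m + 2) = 1 - 1 / (m + 1 : ℝ) := by field_simp; ring
        have h2 : 1 / (m + 1 : ℝ) ≤ 1 / m := by gcongr; linarith
        have h3 : 1 / (4 * m : ℝ) = 1 / 4 * (1 / m) := by field_simp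
        have h4 : 3 / (2 * m : ℝ) = 3 / 2 * (1 / m) := by field_simp
        have h5 : (0 : ℝ) ≤ 1 / m := by positivity
        rw [h1, h3, h4]; linarith

/-- The constants in the bound for the square of `inverseMoment m (d + 1) / (d + 1)!`. -/
noncomputable def momentConst : ℕ → ℝ
  | 0 => 1
  | 1 => 2 / 5
  | d + 2 => momentConst d / ((d + 1) * (d + 2) * (d + 3)) ^ 2

lemma momentConst_pos : ∀ d, 0 < momentConst d
  | 0 => by simp [momentConst]
  | 1 => by norm_num [momentConst]
  | d + 2 => by
    have := momentConst_pos d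
    rw [momentConst]; positivity

lemma inverseMoment_div_factorial_sq_le {m : ℕ} (hm : m ≠ 0) : ∀ d : ℕ,
    (inverseMoment m (d + 1) / (d + 1).factorial) ^ 2 ≤
      momentConst d * (2 * m) ^ d * Real.exp (-d + d * (d + 2) / (2 * m))
  | 0 => by simp [inverseMoment_one, momentConst]
  | 1 => by
    have h := inverseMoment_two_sq_le hm
    norm_num [momentConst, Nat.factorial] at h ⊢
    linarith
  | d + 2 => by
    have ih := inverseMoment_div_factorial_sq_le hm d
    have hm0 : (0 : ℝ) < m := by positivity
    have hd : (0 : ℝ) < (d : ℝ) + 1 := by positivity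
    have hstep := inverseMoment_add_two_le m hd
    have hK := inverseMoment_pos m hd
    have hK2 := inverseMoment_pos m (s := (d : ℝ) + 1 + 2) (by positivity)
    have hstep2 : inverseMoment m (d + 1 + 2) ≤ inverseMoment m (d + 1) *
        (2 * m / (d + 1)) * Real.exp (-1 + (2 * d + 4) / (2 * m)) := by
      refine hstep.trans ?_
      have h1 : (2 * m + (d + 1 : ℝ)) / (d + 1) ≤
          2 * m / (d + 1) * Real.exp ((d + 1) / (2 * m)) := by
        have h := mul_le_mul_of_nonneg_left (Real.add_one_le_exp ((d + 1 : ℝ) / (2 * m)))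
          (by positivity : (0 : ℝ) ≤ 2 * m / (d + 1))
        refine le_trans (le_of_eq ?_) h
        field_simp; ring
      have h2 : -(2 * m / (2 * m + (d + 1 : ℝ) + 2)) ≤ -1 + (d + 3) / (2 * m) := by
        have h3 : (2 * m / (2 * m + (d + 1 : ℝ) + 2)) = 1 - (d + 3) / (2 * m + d + 3) := by
          field_simp; ring
        have h4 : ((d : ℝ) + 3) / (2 * m + d + 3) ≤ (d + 3) / (2 * m) := by
          gcongr; linarith
        rw [h3]; linarith
      calc _ ≤ inverseMoment m (d + 1) * (2 * m / (d + 1) * Real.exp ((d + 1) / (2 * m))) *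
            Real.exp (-1 + (d + 3) / (2 * m)) := by gcongr
        _ = inverseMoment m (d + 1) * (2 * m / (d + 1)) *
            Real.exp ((d + 1) / (2 * m) + (-1 + (d + 3) / (2 * m))) := by
            rw [Real.exp_add ((d + 1) / (2 * m))]; ring
        _ = _ := by congr 2; ring
    have hfac : ((d + 2 + 1).factorial : ℝ) = (d + 3) * (d + 2) * (d + 1).factorial := by
      rw [Nat.factorial_succ, Nat.factorial_succ]; push_cast; ring
    have hcast : (((d + 2 : ℕ) : ℝ) + 1) = d + 1 + 2 := by push_cast; ring
    rw [hcast, hfac]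
    calc _ ≤ (inverseMoment m (d + 1) * (2 * m / (d + 1)) *
          Real.exp (-1 + (2 * d + 4) / (2 * m)) /
            ((d + 3) * (d + 2) * (d + 1).factorial)) ^ 2 := by gcongr
      _ = (inverseMoment m (d + 1) / (d + 1).factorial) ^ 2 * ((2 * m) ^ 2 *
          Real.exp (-2 + (4 * d + 8) / (2 * m)) / ((d + 1) * (d + 2) * (d + 3)) ^ 2) := by
          have : Real.exp (-2 + (4 * d + 8) / (2 * m)) =
              Real.exp (-1 + (2 * d + 4) / (2 * m)) ^ 2 := by
            rw [← Real.exp_nat_mul]; congr 1; push_cast; ring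
          rw [this]; field_simp
      _ ≤ momentConst d * (2 * m) ^ d * Real.exp (-d + d * (d + 2) / (2 * m)) * ((2 * m) ^ 2 *
          Real.exp (-2 + (4 * d + 8) / (2 * m)) / ((d + 1) * (d + 2) * (d + 3)) ^ 2) := by
          gcongr
      _ = momentConst d / ((d + 1) * (d + 2) * (d + 3)) ^ 2 * (2 * m) ^ (d + 2) *
          Real.exp (-d + d * (d + 2) / (2 * m) + (-2 + (4 * d + 8) / (2 * m))) := by
          rw [Real.exp_add (-d + d * (d + 2) / (2 * m))]; ring
      _ = _ := by
          rw [momentConst]; congr 2; push_cast; ring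

lemma pow_le_exp_of_pow_le {A : ℝ} (a b : ℕ) {c : ℝ} (hb : b ≠ 0)
    (h : A ^ b ≤ 2.7182818283 ^ a) (hc : (a : ℝ) / b ≤ c) : A ≤ Real.exp c := by
  have h1 : A ^ b ≤ Real.exp (a / b) ^ b := by
    rw [← Real.exp_nat_mul, mul_div_cancel₀ _ (by positivity), ← mul_one (a : ℝ), Real.exp_nat_mul]
    exact h.trans (by gcongr; exact Real.exp_one_gt_d9.le)
  exact (le_of_pow_le_pow_left₀ hb (by positivity) h1).trans (Real.exp_le_exp.2 hc)

lemma momentConst_mul_pow_le : ∀ d : ℕ, 1 ≤ d →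
    momentConst d * (52 * d) ^ d ≤ 625 * Real.exp (26 / 25 * d - 3 / 52 * (d + 1))
  | 0, h => by lia
  | 1, _ => by
    rw [← div_le_iff₀' (by positivity)]
    exact pow_le_exp_of_pow_le 9 10 (by norm_num) (by norm_num [momentConst])
      (by norm_num)
  | 2, _ => by
    rw [← div_le_iff₀' (by positivity)]
    exact pow_le_exp_of_pow_le 19 10 (by norm_num) (by norm_num [momentConst])
      (by norm_num)
  | 3, _ => by
    rw [← div_le_iff₀' (by positivity)]
    exact pow_le_exp_of_pow_le 28 10 (by norm_num) (by norm_num [momentConst])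
      (by norm_num)
  | 4, _ => by
    rw [← div_le_iff₀' (by positivity)]
    exact pow_le_exp_of_pow_le 38 10 (by norm_num) (by norm_num [momentConst])
      (by norm_num)
  | 5, _ => by
    rw [← div_le_iff₀' (by positivity)]
    exact pow_le_exp_of_pow_le 48 10 (by norm_num) (by norm_num [momentConst])
      (by norm_num)
  | 6, _ => by
    rw [← div_le_iff₀' (by positivity)]
    exact pow_le_exp_of_pow_le 58 10 (by norm_num) (by norm_num [momentConst])
      (by norm_num)
  | 7, _ => by
    rw [← div_le_iff₀' (by positivity)]
    exact pow_le_exp_of_pow_le 68 10 (by norm_num) (by norm_num [momentConst])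
      (by norm_num)
  | d + 8, _ => by
    have ih := momentConst_mul_pow_le (d + 6) (by lia)
    have hpos := momentConst_pos (d + 6)
    set e := d + 6 with he
    have he6 : (6 : ℝ) ≤ e := by rw [he]; push_cast; linarith [Nat.cast_nonneg (α := ℝ) d]
    have h1 : ((e + 2 : ℝ) / e) ^ e ≤ Real.exp 2 := by
      have h := Real.add_one_le_exp (2 / e : ℝ)
      calc ((e + 2 : ℝ) / e) ^ e ≤ Real.exp (2 / e) ^ e := by
            gcongr
            refine le_trans (le_of_eq ?_) h
            field_simp; ring
        _ = _ := by rw [← Real.exp_nat_mul]; congr 1; field_simp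
    have h2 : (52 : ℝ) / ((e + 1) * (e + 3)) ≤ Real.exp (-(1 / 50)) := by
      have h := Real.add_one_le_exp (-(1 / 50 : ℝ))
      refine le_trans ?_ h
      rw [div_le_iff₀ (by positivity)]
      nlinarith
    have hcast : ((d + 8 : ℕ) : ℝ) = e + 2 := by rw [he]; push_cast; ring
    have hrec : momentConst (d + 8) = momentConst e / ((e + 1) * (e + 2) * (e + 3)) ^ 2 := rfl
    rw [hcast, hrec, show d + 8 = e + 2 from rfl]
    clear_value e
    calc momentConst e / ((e + 1) * (e + 2) * (e + 3)) ^ 2 * (52 * (e + 2 : ℝ)) ^ (e + 2)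
        = (momentConst e * (52 * e) ^ e) * ((e + 2 : ℝ) / e) ^ e *
          (52 / ((e + 1) * (e + 3))) ^ 2 := by
          rw [div_pow, pow_add]; simp only [mul_pow, div_pow]; field_simp
      _ ≤ (625 * Real.exp (26 / 25 * e - 3 / 52 * (e + 1))) * Real.exp 2 *
          Real.exp (-(1 / 50)) ^ 2 := by gcongr
      _ = 625 * Real.exp (26 / 25 * e - 3 / 52 * (e + 1) + 2 + (2 : ℕ) * (-(1 / 50))) := by
          rw [Real.exp_add, Real.exp_add, Real.exp_nat_mul]; ring
      _ ≤ _ := by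
          gcongr
          push_cast; linarith

lemma inverseMoment_div_factorial_le {n d : ℕ} (hn : n ≠ 0) (hd : 13 * (d + 1) ≤ 3 * n) :
    inverseMoment (2 * n) (d + 1) / (d + 1).factorial ≤
      25 * Real.exp (n / 26 - 12 / 25 * d) := by
  have hn0 : (0 : ℝ) < n := by positivity
  rcases Nat.eq_zero_or_pos d with rfl | hd0
  · simp [inverseMoment_one]
    have := Real.one_le_exp (by positivity : (0 : ℝ) ≤ n / 26)
    linarith
  have hd1 : (0 : ℝ) < d := by positivity
  have hd' : 13 * ((d : ℝ) + 1) ≤ 3 * n := by exact_mod_cast hd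
  have h1 := inverseMoment_div_factorial_sq_le (m := 2 * n) (by positivity) d
  have h2 := momentConst_mul_pow_le d hd0
  have hc := momentConst_pos d
  have h3 : (2 * (2 * n) : ℝ) ^ d ≤ (52 * d) ^ d * Real.exp (n / 13 - d) := by
    have h := Real.add_one_le_exp (n / (13 * d) - 1 : ℝ)
    calc (2 * (2 * n) : ℝ) ^ d ≤ (52 * d * Real.exp (n / (13 * d) - 1)) ^ d := by
          refine pow_le_pow_left₀ (by positivity) ?_ d
          refine le_trans (le_of_eq ?_) (mul_le_mul_of_nonneg_left h
            (by positivity : (0 : ℝ) ≤ 52 * d))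
          field_simp; ring
      _ = _ := by
        rw [mul_pow, ← Real.exp_nat_mul]; congr 2; field_simp
  have h4 : (d * (d + 2) / (2 * (2 * n)) : ℝ) ≤ 3 / 52 * (d + 1) := by
    rw [div_le_iff₀ (by positivity)]; nlinarith
  refine le_of_pow_le_pow_left₀ two_ne_zero (by positivity) ?_
  push_cast at h1
  calc _ ≤ _ := h1
    _ ≤ momentConst d * ((52 * d) ^ d * Real.exp (n / 13 - d)) *
        Real.exp (-d + 3 / 52 * (d + 1)) := by gcongr
    _ = momentConst d * (52 * d) ^ d * (Real.exp (n / 13 - d) *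
        Real.exp (-d + 3 / 52 * (d + 1))) := by ring
    _ ≤ 625 * Real.exp (26 / 25 * d - 3 / 52 * (d + 1)) * (Real.exp (n / 13 - d) *
        Real.exp (-d + 3 / 52 * (d + 1))) := by gcongr
    _ = 625 * Real.exp (n / 13 - 24 / 25 * d) := by
        rw [← Real.exp_add, mul_assoc, ← Real.exp_add]; congr 2; ring
    _ = _ := by
        rw [mul_pow, ← Real.exp_nat_mul]; norm_num; ring_nf

lemma inv_sqrt_one_sub_le {z : ℝ} (hz : z < 1) :
    (√(1 - z))⁻¹ ≤ Real.exp (z / (2 * (1 - z))) := by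
  have h1 : 0 < 1 - z := by linarith
  have h := Real.add_one_le_exp (z / (1 - z))
  rw [← Real.sqrt_inv]
  refine Real.sqrt_le_iff.mpr ⟨(Real.exp_pos _).le, ?_⟩
  rw [← Real.exp_nat_mul]
  refine le_trans (le_of_eq ?_) (h.trans (le_of_eq ?_))
  · field_simp; ring
  · congr 1; push_cast; field_simp

lemma inv_sqrt_one_add_le {y : ℝ} (hy : 0 ≤ y) :
    (√(1 + y))⁻¹ ≤ Real.exp (-(y / (2 * (1 + y)))) := by
  have h := inv_sqrt_one_sub_le (z := y / (1 + y)) (by rw [div_lt_one] <;> linarith)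
  have h1 : 0 < 1 + y := by linarith
  have e1 : 1 - y / (1 + y) = (1 + y)⁻¹ := by field_simp; ring
  rw [e1, Real.sqrt_inv, inv_inv] at h
  rw [Real.exp_neg]
  have h2 := Real.add_one_le_exp (-(y / (1 + y)))
  rw [← Real.exp_neg, ← Real.sqrt_inv]
  refine Real.sqrt_le_iff.mpr ⟨(Real.exp_pos _).le, ?_⟩
  rw [← Real.exp_nat_mul]
  refine le_trans (le_of_eq ?_) (h2.trans (le_of_eq ?_))
  · field_simp; ring
  · congr 1; push_cast; field_simp

lemma laplaceRatio_le {n d : ℝ} (hn : 39 ≤ n) (hd : 0 ≤ d) (hdn : 13 * (d + 1) ≤ 3 * n) :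
    -(5 * d / (22 * n) / (2 * (1 + 5 * d / (22 * n)))) +
      d * (5 / (2 * n) / (2 * (1 - 5 / (2 * n)))) ≤ 2 * (307 / 500 * (d / n)) := by
  have hn0 : 0 < n := by linarith
  have hy : 5 * d / (22 * n) ≤ 15 / 286 := by
    rw [div_le_iff₀ (by positivity)]; linarith
  have e1 : 715 / 6622 * (d / n) ≤ 5 * d / (22 * n) / (2 * (1 + 5 * d / (22 * n))) := by
    rw [le_div_iff₀ (by positivity)]
    have : 5 * d / (22 * n) = 5 / 22 * (d / n) := by field_simp
    rw [this] at hy ⊢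
    have hx : 0 ≤ d / n := by positivity
    nlinarith
  have e2 : d * (5 / (2 * n) / (2 * (1 - 5 / (2 * n)))) ≤ 195 / 146 * (d / n) := by
    have : d * (5 / (2 * n) / (2 * (1 - 5 / (2 * n)))) = d / n * (5 * n / (2 * (2 * n - 5))) := by
      have : 2 * n - 5 ≠ 0 := by linarith
      have : 1 - 5 / (2 * n) ≠ 0 := by
        have : 1 - 5 / (2 * n) = (2 * n - 5) / (2 * n) := by field_simp
        rw [this]; positivity
      field_simp
    rw [this, mul_comm]
    refine mul_le_mul_of_nonneg_right ?_ (by positivity)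
    rw [div_le_iff₀ (by linarith)]; linarith
  have hx : 0 ≤ d / n := by positivity
  linarith

lemma half_one_add_sqrt_pow_le {n d : ℕ} (hn : 39 ≤ n) (hd : 13 * (d + 1) ≤ 3 * n) :
    ((1 + √((√(11 + 5 * (d : ℝ) / (2 * n)))⁻¹ * (√(1 - 5 / (2 * (n : ℝ))))⁻¹ ^ d)) / 2) ^ n ≤
      Real.exp (-(5107 / 20000) * n + 6 / 25 * d) := by
  have hn' : (39 : ℝ) ≤ n := by exact_mod_cast hn
  have hn0 : (0 : ℝ) < n := by linarith
  have hd' : 13 * ((d : ℝ) + 1) ≤ 3 * n := by exact_mod_cast hd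
  have hz : 5 / (2 * (n : ℝ)) < 1 := by rw [div_lt_one (by positivity)]; linarith
  have hx0 : 0 ≤ (d : ℝ) / n := by positivity
  have hx1 : (d : ℝ) / n ≤ 3 / 13 := by rw [div_le_iff₀ hn0]; linarith
  set x : ℝ := 307 / 500 * (d / n) with hx
  have hb : (√(11 + 5 * (d : ℝ) / (2 * n)))⁻¹ ≤
      (5492 / 10000) ^ 2 * Real.exp (-(5 * d / (22 * n) / (2 * (1 + 5 * d / (22 * n))))) := by
    have h11 : 11 + 5 * (d : ℝ) / (2 * n) = 11 * (1 + 5 * d / (22 * n)) := by field_simp; ring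
    rw [h11, Real.sqrt_mul (by norm_num), mul_inv]
    refine mul_le_mul ?_ (inv_sqrt_one_add_le (by positivity)) (by positivity) (by positivity)
    rw [← Real.sqrt_inv]
    refine Real.sqrt_le_iff.mpr ⟨by norm_num, by norm_num⟩
  have hroot : √((√(11 + 5 * (d : ℝ) / (2 * n)))⁻¹ * (√(1 - 5 / (2 * (n : ℝ))))⁻¹ ^ d) ≤
      5492 / 10000 * Real.exp x := by
    refine Real.sqrt_le_iff.mpr ⟨by positivity, ?_⟩
    calc _ ≤ _ := mul_le_mul hb (pow_le_pow_left₀ (by positivity) (inv_sqrt_one_sub_le hz) d)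
          (by positivity) (by positivity)
      _ = (5492 / 10000) ^ 2 * Real.exp
          (-(5 * d / (22 * n) / (2 * (1 + 5 * d / (22 * n)))) +
            d * (5 / (2 * n) / (2 * (1 - 5 / (2 * n))))) := by
          rw [← Real.exp_nat_mul, mul_assoc, ← Real.exp_add]
      _ ≤ (5492 / 10000) ^ 2 * Real.exp (2 * x) := by
          gcongr
          exact laplaceRatio_le hn' (by positivity) hd'
      _ = _ := by
          rw [mul_pow, ← Real.exp_nat_mul]; norm_num
  have hexp : Real.exp x ≤ 1 + 11 / 10 * x := by
    have h0 : 0 ≤ x := by positivity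
    have h1 : x ≤ 1 / 7 := by rw [hx]; linarith
    have h := Real.exp_bound' h0 (by linarith) (n := 3) (by norm_num)
    norm_num [Finset.sum_range_succ, Nat.factorial] at h
    have h2 : x ^ 2 ≤ 1 / 7 * x := by nlinarith
    have h3 : x ^ 3 ≤ 1 / 49 * x := by nlinarith
    linarith
  have hbase : (1 + 5492 / 10000 : ℝ) / 2 ≤ Real.exp (-(5107 / 20000)) := by
    have h := Real.exp_bound' (x := 5107 / 20000) (by norm_num) (by norm_num) (n := 6) (by norm_num)
    rw [Real.exp_neg]
    rw [le_inv_comm₀ (by norm_num) (Real.exp_pos _)]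
    refine h.trans ?_
    norm_num [Finset.sum_range_succ, Nat.factorial]
  have hmain : (1 + √((√(11 + 5 * (d : ℝ) / (2 * n)))⁻¹ * (√(1 - 5 / (2 * (n : ℝ))))⁻¹ ^ d)) / 2 ≤
      Real.exp (-(5107 / 20000)) * Real.exp (6 / 25 * (d / n)) := by
    have h := Real.add_one_le_exp (6 / 25 * ((d : ℝ) / n))
    calc _ ≤ (1 + 5492 / 10000 * (1 + 11 / 10 * x)) / 2 := by
          have := mul_le_mul_of_nonneg_left hexp (by norm_num : (0 : ℝ) ≤ 5492 / 10000)
          linarith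
      _ ≤ (1 + 5492 / 10000 : ℝ) / 2 * (6 / 25 * ((d : ℝ) / n) + 1) := by
          rw [hx]; linarith
      _ ≤ _ := mul_le_mul hbase h (by positivity) (by positivity)
  calc _ ≤ _ := pow_le_pow_left₀ (by positivity) hmain n
    _ = _ := by
      rw [← Real.exp_add, ← Real.exp_nat_mul]; congr 1; field_simp

lemma mul_le_of_mul_log_le {n p s : ℕ} (hp : 3 ≤ p)
    (h : 4 * (s : ℝ) * Real.log p ≤ n) : 13 * s ≤ 3 * n := by
  have h3 : (13 / 12 : ℝ) ≤ Real.log 3 := by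
    rw [Real.le_log_iff_exp_le (by norm_num)]
    have h1 := Real.exp_one_lt_d9
    refine le_of_pow_le_pow_left₀ (n := 12) (by norm_num) (by norm_num) ?_
    rw [← Real.exp_nat_mul]
    have : Real.exp ((12 : ℕ) * (13 / 12)) = Real.exp 1 ^ 13 := by
      rw [← Real.exp_nat_mul]; norm_num
    rw [this]
    calc Real.exp 1 ^ 13 ≤ 2.7182818286 ^ 13 := by gcongr
      _ ≤ _ := by norm_num
  have hp' : (3 : ℝ) ≤ p := by exact_mod_cast hp
  have h4 := Real.log_le_log (by norm_num) hp'
  have hs : (0 : ℝ) ≤ s := by positivity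
  have : (13 * s : ℝ) ≤ 3 * n := by nlinarith
  exact_mod_cast this

lemma choose_mul_inverseMoment_le {n p d : ℕ} (hp : 3 ≤ p) (hn : n ≠ 0)
    (h : 4 * ((d + 1 : ℕ) : ℝ) * Real.log p ≤ n) :
    p.choose (d + 1) * inverseMoment (2 * n) (d + 1) ≤
      25 * Real.exp (n / 4 + n / 26 - 12 / 25 * d) := by
  have hm := inverseMoment_div_factorial_le hn (mul_le_of_mul_log_le hp h)
  have hp0 : (0 : ℝ) < p := by positivity
  have hpow : (p : ℝ) ^ (d + 1) ≤ Real.exp (n / 4) := by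
    rw [← Real.exp_log hp0, ← Real.exp_nat_mul, Real.exp_le_exp]
    linarith
  have hpos := inverseMoment_pos (2 * n) (s := (d + 1 : ℝ)) (by positivity)
  calc _ ≤ (p : ℝ) ^ (d + 1) / (d + 1).factorial * inverseMoment (2 * n) (d + 1) := by
        gcongr
        exact Nat.choose_le_pow_div (d + 1) p
    _ = p ^ (d + 1) * (inverseMoment (2 * n) (d + 1) / (d + 1).factorial) := by ring
    _ ≤ Real.exp (n / 4) * (25 * Real.exp (n / 26 - 12 / 25 * d)) := by gcongr
    _ = _ := by
      rw [mul_left_comm, ← Real.exp_add]; congr 2; ring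

/-- uniform lower bound on `λ_min(V_{n,S})` in Poisson regression. -/
theorem stmt_15 (n p sstar : ℕ) (hn : 1 ≤ n) (hs : 1 ≤ sstar) (hsp : sstar ≤ p)
    (hp : 3 ≤ p) (hsample : 4 * (sstar : ℝ) * Real.log p ≤ (n : ℝ))
    (θ₀ : Fin p → ℝ) :
    gaussMat n p {x | ∃ S : Finset (Fin p), S.Nonempty ∧ S.card ≤ sstar ∧
        lamMin (gramW S (fun i => Real.exp (∑ j, x i j * θ₀ j)) x) ≤ (n : ℝ) / 36}
      ≤ ENNReal.ofReal (5 * Real.exp (-(n : ℝ) / 24)) := by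
  rcases lt_or_ge n 39 with hn39 | hn39
  · refine prob_le_one.trans ?_
    rw [ENNReal.one_le_ofReal]
    have hn' : (n : ℝ) ≤ 38 := by exact_mod_cast Nat.le_of_lt_succ hn39
    have h5 : Real.exp (38 / 24) ≤ 5 := by
      refine le_of_pow_le_pow_left₀ (n := 12) (by norm_num) (by norm_num) ?_
      have : Real.exp (38 / 24) ^ 12 = Real.exp 1 ^ 19 := by
        rw [← Real.exp_nat_mul, ← Real.exp_nat_mul]; norm_num
      rw [this]
      calc Real.exp 1 ^ 19 ≤ 2.7182818286 ^ 19 := by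
            gcongr
            exact Real.exp_one_lt_d9.le
        _ ≤ _ := by norm_num
    calc (1 : ℝ) = Real.exp (38 / 24) * Real.exp (-(38 / 24)) := by
          rw [← Real.exp_add]; simp
      _ ≤ 5 * Real.exp (-n / 24) := by
          gcongr
          linarith
  obtain ⟨d, rfl⟩ := Nat.exists_eq_add_of_le' hs
  have hd := mul_le_of_mul_log_le hp hsample
  have hn' : (39 : ℝ) ≤ n := by exact_mod_cast hn39
  rw [← ofReal_measureReal]
  refine ENNReal.ofReal_le_ofReal ?_
  have hb := measureReal_exists_lamMin_le (n := n) hs hsp (m := 2 * n) (by lia) θ₀ (l := 5)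
    (t := (n : ℝ) / 36) (by norm_num)
    (by push_cast; rw [div_lt_iff₀ (by positivity)]; linarith)
  refine hb.trans ?_
  have hmom : ((∏ k ∈ Finset.range (2 * n), ((2 * k + 1 : ℝ) / (2 * k + (d + 1 : ℕ)))) *
      ((2 * (2 * n : ℕ) + (d + 1 : ℕ)) / (2 * (2 * n : ℕ) + 1) : ℝ) ^ (2 * n) *
      Real.exp (-5 * (n / 36)))⁻¹ = inverseMoment (2 * n) (d + 1) * Real.exp (5 * (n / 36)) := by
    rw [mul_inv, mul_inv, ← Finset.prod_inv_distrib, ← inv_pow, ← Real.exp_neg, inverseMoment]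
    simp only [inv_div]
    push_cast
    rw [neg_mul, neg_neg]
  have hquad : √(1 + 2 * (5 * (2 * (2 * n : ℕ) + (d + 1 : ℕ)) / (2 * (2 * n : ℕ))) -
      2 * (5 / (2 * (2 * n : ℕ))) : ℝ) = √(11 + 5 * d / (2 * n)) := by
    congr 1
    push_cast
    field_simp
    ring
  have hlin : √(1 - 2 * (5 / (2 * (2 * n : ℕ))) : ℝ) = √(1 - 5 / (2 * n)) := by
    congr 1
    push_cast
    field_simp
  rw [hmom, hquad, hlin, Nat.add_sub_cancel]
  have hroot : √(p.choose (d + 1) * (inverseMoment (2 * n) (d + 1) * Real.exp (5 * (n / 36)))) ≤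
      5 * Real.exp ((n / 4 + n / 26 - 12 / 25 * d + 5 * (n / 36)) / 2) := by
    refine Real.sqrt_le_iff.mpr ⟨by positivity, ?_⟩
    calc _ = p.choose (d + 1) * inverseMoment (2 * n) (d + 1) * Real.exp (5 * (n / 36)) := by ring
      _ ≤ 25 * Real.exp (n / 4 + n / 26 - 12 / 25 * d) * Real.exp (5 * (n / 36)) := by
          refine mul_le_mul_of_nonneg_right ?_ (Real.exp_pos _).le
          exact choose_mul_inverseMoment_le hp (by lia) hsample
      _ = _ := by
          rw [mul_assoc, ← Real.exp_add, mul_pow, ← Real.exp_nat_mul]; norm_num; ring_nf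
  calc _ ≤ _ := mul_le_mul hroot (half_one_add_sqrt_pow_le hn39 hd) (by positivity) (by positivity)
    _ = 5 * Real.exp ((n / 4 + n / 26 - 12 / 25 * d + 5 * (n / 36)) / 2 +
        (-(5107 / 20000) * n + 6 / 25 * d)) := by rw [mul_assoc, ← Real.exp_add]
    _ ≤ _ := by
        gcongr
        linarith
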